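/- arXiv:1503.05301 — 9 statements merged into one kernel-verified Lean document; each statement's English description precedes it below -/
import Mathlib

section
/- Let a, d, r, x₀ be real numbers and let λ₁, λ₂ be two distinct real numbers satisfying λ₁ + λ₂ = a + 2r and λ₁·λ₂ = r² + (a − d)r (i.e., they are the roots of λ² − (a+2r)λ + (r² + (a−d)r) = 0), and set B = a² + (a+d)r. A sequence (xₙ) of real numbers with x₀ given satisfies the recurrence x_{n+1} = Σ_{k=0}^{n} (a + k·d)·r^k·x_{n−k} for all n ≥ 0 if and only if for every n ≥ 1, xₙ = (x₀/(λ₁ − λ₂))·[(B − a·λ₂)·λ₁^{n−1} − (B − a·λ₁)·λ₂^{n−1}]. -/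
/-- The sums weighted by an arithmetic-geometric progression obey a second-order
inhomogeneous linear recurrence. -/
theorem arith_geom_sum_recurrence (a d r : ℝ) (x : ℕ → ℝ) (n : ℕ) :
    (∑ k ∈ Finset.range (n + 3), (a + (k : ℝ) * d) * r ^ k * x (n + 2 - k)) =
      2 * r * (∑ k ∈ Finset.range (n + 2), (a + (k : ℝ) * d) * r ^ k * x (n + 1 - k))
      - r ^ 2 * (∑ k ∈ Finset.range (n + 1), (a + (k : ℝ) * d) * r ^ k * x (n - k))
      + a * x (n + 2) + (d - a) * r * x (n + 1) := by
  have geom_step (m : ℕ) : (∑ k ∈ Finset.range (m + 2), r ^ k * x (m + 1 - k)) =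
      x (m + 1) + r * ∑ k ∈ Finset.range (m + 1), r ^ k * x (m - k) := by
    rw [Finset.sum_range_succ', Finset.mul_sum, add_comm]
    congr 1
    · simp
    · refine Finset.sum_congr rfl fun k _ => ?_
      rw [Nat.add_sub_add_right]
      ring
  have arith_step (m : ℕ) :
      (∑ k ∈ Finset.range (m + 2), (a + (k : ℝ) * d) * r ^ k * x (m + 1 - k)) =
        a * x (m + 1) + (r * (∑ k ∈ Finset.range (m + 1), (a + (k : ℝ) * d) * r ^ k * x (m - k))
          + d * r * ∑ k ∈ Finset.range (m + 1), r ^ k * x (m - k)) := by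
    rw [Finset.sum_range_succ', Finset.mul_sum, Finset.mul_sum, ← Finset.sum_add_distrib, add_comm]
    congr 1
    · simp
    · refine Finset.sum_congr rfl fun k _ => ?_
      rw [Nat.add_sub_add_right]
      push_cast
      ring
  linear_combination arith_step (n + 1) - r * arith_step n + d * r * geom_step n

/-- The full-history recurrence is equivalent to a second-order one with two initial values. -/
theorem arith_geom_recurrence_iff_second_order (a d r : ℝ) (x : ℕ → ℝ) :
    (∀ n : ℕ, x (n + 1) = ∑ k ∈ Finset.range (n + 1), (a + (k : ℝ) * d) * r ^ k * x (n - k)) ↔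
      x 1 = a * x 0 ∧ x 2 = (a ^ 2 + (a + d) * r) * x 0 ∧
        ∀ n : ℕ, x (n + 3) = (a + 2 * r) * x (n + 2) - (r ^ 2 + (a - d) * r) * x (n + 1) := by
  constructor
  · intro h
    have h1 : x 1 = a * x 0 := by simpa using h 0
    have h2 : x 2 = a * x 1 + (a + d) * r * x 0 := by simpa [Finset.sum_range_succ] using h 1
    refine ⟨h1, by linear_combination h2 + a * h1, fun n => ?_⟩
    linear_combination h (n + 2) + arith_geom_sum_recurrence a d r x n
      - 2 * r * h (n + 1) + r ^ 2 * h n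
  · rintro ⟨h1, h2, h⟩ n
    induction n using Nat.twoStepInduction with
    | zero => simpa using h1
    | one =>
      simp only [Finset.sum_range_succ, Finset.sum_range_zero]
      norm_num
      linear_combination h2 - a * h1
    | more n ih ih' =>
      linear_combination h n - arith_geom_sum_recurrence a d r x n + 2 * r * ih' - r ^ 2 * ih

/-- Binet's formula for a second-order linear recurrence with distinct characteristic roots. -/
theorem second_order_recurrence_iff_binet (l1 l2 : ℝ) (hne : l1 ≠ l2) (y : ℕ → ℝ) (u v : ℝ) :
    (y 0 = u ∧ y 1 = v ∧ ∀ n : ℕ, y (n + 2) = (l1 + l2) * y (n + 1) - l1 * l2 * y n) ↔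
      ∀ n : ℕ, y n = ((v - u * l2) * l1 ^ n - (v - u * l1) * l2 ^ n) / (l1 - l2) := by
  have hd : l1 - l2 ≠ 0 := sub_ne_zero.mpr hne
  constructor
  · rintro ⟨h0, h1, h⟩ n
    induction n using Nat.twoStepInduction with
    | zero => rw [h0]; field_simp; ring
    | one => rw [h1]; field_simp; ring
    | more n ih ih' => rw [h, ih, ih']; field_simp; ring
  · intro h
    refine ⟨?_, ?_, fun n => ?_⟩
    · rw [h]; field_simp; ring
    · rw [h]; field_simp; ring
    · rw [h, h, h]; field_simp; ring

/-- A sequence satisfies the full-history recurrence with coefficients in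
arithmetic-geometric progression iff it obeys the Binet-type formula. -/
theorem arith_geom_recurrence_iff_binet
    (a d r x₀ : ℝ) (l1 l2 : ℝ) (hne : l1 ≠ l2)
    (hsum : l1 + l2 = a + 2 * r) (hprod : l1 * l2 = r ^ 2 + (a - d) * r)
    (B : ℝ) (hB : B = a ^ 2 + (a + d) * r)
    (x : ℕ → ℝ) (hx0 : x 0 = x₀) :
    (∀ n : ℕ, x (n + 1) = ∑ k ∈ Finset.range (n + 1), (a + (k : ℝ) * d) * r ^ k * x (n - k)) ↔
    (∀ n : ℕ, 1 ≤ n →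
      x n = x₀ / (l1 - l2) * ((B - a * l2) * l1 ^ (n - 1) - (B - a * l1) * l2 ^ (n - 1))) := by
  subst hx0 hB
  have key := second_order_recurrence_iff_binet l1 l2 hne (fun n => x (n + 1)) (a * x 0)
    ((a ^ 2 + (a + d) * r) * x 0)
  rw [hsum, hprod] at key
  rw [arith_geom_recurrence_iff_second_order]
  refine key.trans ⟨fun h n hn => ?_, fun h n => ?_⟩
  · obtain ⟨m, rfl⟩ := Nat.exists_eq_add_of_le' hn
    refine (h m).trans ?_
    rw [Nat.add_sub_cancel]
    ring
  · refine (h (n + 1) (Nat.le_add_left 1 n)).trans ?_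
    rw [Nat.add_sub_cancel]
    ring
end

section
/- Let a, d, r be real numbers and let (xₙ) be a sequence of real numbers satisfying x_{n+1} = Σ_{k=0}^{n} (a + k·d)·r^k·x_{n−k} for all n ≥ 0. Then x₁ = a·x₀, x₂ = (a² + (a+d)·r)·x₀, and for all n ≥ 2, x_{n+1} = (a + 2r)·xₙ − (r² + (a − d)·r)·x_{n−1}. That is, the full-history recurrence reduces to a second-order linear recurrence with constant coefficients P = a + 2r and Q = −(r² + (a−d)r). -/
/-- Splitting off the most recent term of a geometrically weighted history sum. -/
theorem sum_geom_history_succ {R : Type*} [CommSemiring R] (d r : R) (x : ℕ → R) (n : ℕ) :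
    ∑ k ∈ Finset.range (n + 2), d * r ^ k * x (n + 1 - k) =
      d * x (n + 1) + r * ∑ k ∈ Finset.range (n + 1), d * r ^ k * x (n - k) := by
  rw [Finset.sum_range_succ', Finset.mul_sum, add_comm]
  congr 1
  · simp
  · refine Finset.sum_congr rfl fun k _ => ?_
    rw [Nat.add_sub_add_right]
    ring

/-- Splitting off the most recent term of a history sum with arithmetic-geometric weights. -/
theorem sum_arith_geom_history_succ {R : Type*} [CommSemiring R] (a d r : R) (x : ℕ → R) (n : ℕ) :
    ∑ k ∈ Finset.range (n + 2), (a + (k : R) * d) * r ^ k * x (n + 1 - k) =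
      a * x (n + 1) + r * (∑ k ∈ Finset.range (n + 1), (a + (k : R) * d) * r ^ k * x (n - k) +
        ∑ k ∈ Finset.range (n + 1), d * r ^ k * x (n - k)) := by
  rw [Finset.sum_range_succ', ← Finset.sum_add_distrib, Finset.mul_sum, add_comm]
  congr 1
  · simp
  · refine Finset.sum_congr rfl fun k _ => ?_
    rw [Nat.add_sub_add_right]
    push_cast
    ring


/-- The full-history recurrence with arithmetic-geometric coefficients reduces to a
second-order linear recurrence with constant coefficients. -/
theorem arith_geom_recurrence_reduces_to_second_order
    (a d r : ℝ) (x : ℕ → ℝ)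
    (hrec : ∀ n : ℕ, x (n + 1) = ∑ k ∈ Finset.range (n + 1), (a + (k : ℝ) * d) * r ^ k * x (n - k)) :
    x 1 = a * x 0 ∧ x 2 = (a ^ 2 + (a + d) * r) * x 0 ∧
    ∀ n : ℕ, 2 ≤ n → x (n + 1) = (a + 2 * r) * x n - (r ^ 2 + (a - d) * r) * x (n - 1) := by
  have h1 : x 1 = a * x 0 := by simpa using hrec 0
  have step (n : ℕ) : x (n + 2) = a * x (n + 1) +
      r * (x (n + 1) + ∑ k ∈ Finset.range (n + 1), d * r ^ k * x (n - k)) := by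
    rw [hrec (n + 1), sum_arith_geom_history_succ, ← hrec n]
  refine ⟨h1, ?_, fun n hn => ?_⟩
  · have h2 := step 0
    simp only [zero_add, Finset.sum_range_one, pow_zero, Nat.sub_zero, h1] at h2
    rw [h2]
    ring
  · obtain ⟨m, rfl⟩ := Nat.exists_eq_add_of_le' hn
    have h3 := step (m + 1)
    rw [sum_geom_history_succ] at h3
    change x (m + 1 + 2) = (a + 2 * r) * x (m + 2) - (r ^ 2 + (a - d) * r) * x (m + 1)
    linear_combination h3 - r * step m
end

section
/- Let a, d, x₀ be real numbers with a² + 4d > 0, set B = a² + a + d and λ_{1,2} = (a + 2 ± √(a² + 4d))/2. A sequence (xₙ) of real numbers with given x₀ satisfies the recurrence with coefficients in arithmetic progression x_{n+1} = a·xₙ + (a+d)·x_{n−1} + ⋯ + (a + nd)·x₀ for all n ≥ 0 if and only if for every n ≥ 1, xₙ = (x₀/(λ₁ − λ₂))·[(B − a·λ₂)·λ₁^{n−1} − (B − a·λ₁)·λ₂^{n−1}]. -/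
/-- A convolution with coefficients in arithmetic progression grows by a multiple of the newest
term and a multiple of the partial sum of the sequence. -/
lemma sum_arith_mul_succ (a d : ℝ) (x : ℕ → ℝ) (n : ℕ) :
    ∑ k ∈ Finset.range (n + 2), (a + (k : ℝ) * d) * x (n + 1 - k) =
      ∑ k ∈ Finset.range (n + 1), (a + (k : ℝ) * d) * x (n - k) + a * x (n + 1) +
        d * ∑ j ∈ Finset.range (n + 1), x j := by
  rw [Finset.sum_range_succ', ← Finset.sum_range_reflect x, Finset.mul_sum]
  have hsum : ∑ k ∈ Finset.range (n + 1), (a + ((k + 1 : ℕ) : ℝ) * d) * x (n + 1 - (k + 1)) =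
      ∑ k ∈ Finset.range (n + 1), (a + (k : ℝ) * d) * x (n - k) +
        ∑ k ∈ Finset.range (n + 1), d * x (n + 1 - 1 - k) := by
    rw [← Finset.sum_add_distrib]
    refine Finset.sum_congr rfl fun k _ => ?_
    rw [Nat.add_sub_add_right, Nat.add_sub_cancel]
    push_cast
    ring
  rw [hsum]
  simp only [Nat.cast_zero, Nat.sub_zero]
  ring

/-- The recurrence with coefficients in arithmetic progression is equivalent to a second-order
linear recurrence, valid from index one on, together with the values of `x 1` and `x 2`. -/
lemma arith_recurrence_iff_second_order (a d : ℝ) (x : ℕ → ℝ) :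
    (∀ n : ℕ, x (n + 1) = ∑ k ∈ Finset.range (n + 1), (a + (k : ℝ) * d) * x (n - k)) ↔
      x 1 = a * x 0 ∧ x 2 = (a ^ 2 + a + d) * x 0 ∧
        ∀ n : ℕ, x (n + 3) = (a + 2) * x (n + 2) - (1 + a - d) * x (n + 1) := by
  constructor
  · intro hx
    have hstep (n : ℕ) :
        x (n + 2) = (1 + a) * x (n + 1) + d * ∑ j ∈ Finset.range (n + 1), x j := by
      rw [hx (n + 1), sum_arith_mul_succ, ← hx n]
      ring
    have h1 : x 1 = a * x 0 := by simpa using hx 0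
    refine ⟨h1, ?_, fun n => ?_⟩
    · have h2 := hstep 0
      simp only [zero_add, Finset.sum_range_one, h1] at h2
      rw [h2]
      ring
    · have h3 := hstep (n + 1)
      rw [Finset.sum_range_succ] at h3
      linear_combination h3 - hstep n
  · rintro ⟨h1, h2, hrec⟩
    have hsum (n : ℕ) :
        d * ∑ j ∈ Finset.range (n + 1), x j = x (n + 2) - (1 + a) * x (n + 1) := by
      induction n with
      | zero =>
        simp only [zero_add, Finset.sum_range_one, h1, h2]
        ring
      | succ n ih =>
        rw [Finset.sum_range_succ]
        linear_combination ih - hrec n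
    intro n
    induction n with
    | zero => simpa using h1
    | succ n ih =>
      rw [sum_arith_mul_succ, ← ih, hsum]
      ring

/-- A sequence solves a second-order linear recurrence with distinct characteristic roots `p`, `q`
iff it is given by the Binet formula in terms of its first two values. -/
lemma second_order_iff_binet {p q : ℝ} (hpq : p ≠ q) (y : ℕ → ℝ) (u v : ℝ) :
    (y 0 = u ∧ y 1 = v ∧ ∀ n : ℕ, y (n + 2) = (p + q) * y (n + 1) - p * q * y n) ↔
      ∀ n : ℕ, y n = ((v - u * q) * p ^ n - (v - u * p) * q ^ n) / (p - q) := by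
  have hne : p - q ≠ 0 := sub_ne_zero.mpr hpq
  constructor
  · rintro ⟨h0, h1, hrec⟩ n
    induction n using Nat.twoStepInduction with
    | zero =>
      rw [h0]
      field_simp
      ring
    | one =>
      rw [h1]
      field_simp
      ring
    | more n ih ih' =>
      rw [hrec, ih, ih']
      field_simp
      ring
  · intro hy
    refine ⟨?_, ?_, fun n => ?_⟩
    · rw [hy]
      field_simp
      ring
    · rw [hy]
      field_simp
      ring
    · rw [hy, hy, hy]
      field_simp
      ring

/-- A sequence satisfies the recurrence with coefficients in arithmetic progression
iff it obeys the Binet-type formula. -/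
theorem arith_recurrence_iff_binet
    (a d x₀ : ℝ) (h : a ^ 2 + 4 * d > 0)
    (l1 l2 B : ℝ)
    (hl1 : l1 = (a + 2 + Real.sqrt (a ^ 2 + 4 * d)) / 2)
    (hl2 : l2 = (a + 2 - Real.sqrt (a ^ 2 + 4 * d)) / 2)
    (hB : B = a ^ 2 + a + d)
    (x : ℕ → ℝ) (hx0 : x 0 = x₀) :
    (∀ n : ℕ, x (n + 1) = ∑ k ∈ Finset.range (n + 1), (a + (k : ℝ) * d) * x (n - k)) ↔
    (∀ n : ℕ, 1 ≤ n →
      x n = x₀ / (l1 - l2) * ((B - a * l2) * l1 ^ (n - 1) - (B - a * l1) * l2 ^ (n - 1))) := by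
  have hsq := Real.sq_sqrt h.le
  have hpos := Real.sqrt_pos.mpr h
  have hne : l1 ≠ l2 := by
    intro heq
    linarith
  have hadd : l1 + l2 = a + 2 := by
    rw [hl1, hl2]
    ring
  have hmul : l1 * l2 = 1 + a - d := by
    rw [hl1, hl2]
    linear_combination -hsq / 4
  have hbinet := second_order_iff_binet hne (fun n => x (n + 1)) (a * x 0) (B * x 0)
  rw [hadd, hmul, hB] at hbinet
  rw [arith_recurrence_iff_second_order]
  refine hbinet.trans ⟨fun hx n hn => ?_, fun hx n => ?_⟩
  · obtain ⟨m, rfl⟩ := Nat.exists_eq_add_of_le' hn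
    rw [hx m, hB, hx0, Nat.add_sub_cancel]
    ring
  · rw [hx (n + 1) (Nat.le_add_left 1 n), hB, hx0, Nat.add_sub_cancel]
    ring
end

section
/- Let a, r, x₀ be real numbers. A sequence (xₙ) of real numbers with given x₀ satisfies the recurrence with coefficients in geometric progression x_{n+1} = a·xₙ + a·r·x_{n−1} + a·r²·x_{n−2} + ⋯ + a·rⁿ·x₀ for all n ≥ 0 if and only if for every n ≥ 1, xₙ = a·x₀·(a + r)^{n−1}; that is, from the second term on, (xₙ) is a geometric progression with ratio a + r. -/
/-- Horner-type recursion for the convolution of a sequence with a geometric progression. -/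
theorem sum_geom_mul_sub_succ {R : Type*} [CommSemiring R] (a r : R) (x : ℕ → R) (n : ℕ) :
    ∑ k ∈ Finset.range (n + 2), a * r ^ k * x (n + 1 - k) =
      a * x (n + 1) + r * ∑ k ∈ Finset.range (n + 1), a * r ^ k * x (n - k) := by
  rw [Finset.sum_range_succ', add_comm, Finset.mul_sum]
  congr 1
  · simp
  · refine Finset.sum_congr rfl fun k _ => ?_
    rw [Nat.add_sub_add_right]
    ring

/-- A sequence satisfies the recurrence with coefficients in geometric progression
iff, from the second term on, it is a geometric progression with ratio `a + r`. -/
theorem geom_recurrence_iff_geometric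
    (a r x₀ : ℝ) (x : ℕ → ℝ) (hx0 : x 0 = x₀) :
    (∀ n : ℕ, x (n + 1) = ∑ k ∈ Finset.range (n + 1), a * r ^ k * x (n - k)) ↔
    (∀ n : ℕ, 1 ≤ n → x n = a * x₀ * (a + r) ^ (n - 1)) := by
  constructor
  · intro h n hn
    induction n, hn using Nat.le_induction with
    | base => simpa [hx0] using h 0
    | succ n hn ih =>
      obtain ⟨m, rfl⟩ := Nat.exists_eq_add_of_le' hn
      rw [h (m + 1), sum_geom_mul_sub_succ, ← h m, ih]
      simp only [Nat.add_sub_cancel]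
      ring
  · intro h n
    induction n with
    | zero => simp [h 1 le_rfl, hx0]
    | succ n ih =>
      rw [sum_geom_mul_sub_succ, ← ih, h (n + 1 + 1) (by lia), h (n + 1) (by lia)]
      simp only [Nat.add_sub_cancel]
      ring
end

section
/- Let (xₙ) be the sequence of real numbers with x₀ = 4/5 satisfying the recurrence x_{n+1} = Σ_{k=0}^{n} (5k/2)·(1/2)^k·x_{n−k} for all n ≥ 0 (the arithmetic-geometric coefficient recurrence with a = 0, d = 5/2, r = 1/2). Then for every n ≥ 1, xₙ equals the Fibonacci number F_{n−1}; equivalently, xₙ = (φ^{n−1} − (1−φ)^{n−1})/√5 where φ = (1+√5)/2. -/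
/-- Geometric convolutions satisfy a first-order recurrence. -/
theorem sum_geom_conv_succ (r : ℝ) (x : ℕ → ℝ) (n : ℕ) :
    ∑ k ∈ Finset.range (n + 2), r ^ k * x (n + 1 - k) =
      x (n + 1) + r * ∑ k ∈ Finset.range (n + 1), r ^ k * x (n - k) := by
  rw [Finset.sum_range_succ', Finset.mul_sum, add_comm]
  congr 1
  · simp
  · refine Finset.sum_congr rfl fun k _ => ?_
    rw [Nat.add_sub_add_right]
    ring

/-- Arithmetic-geometric convolutions satisfy a first-order recurrence whose inhomogeneous part
consists of `x (n + 1)` and a geometric convolution. -/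
theorem sum_arith_geom_conv_succ (a d r : ℝ) (x : ℕ → ℝ) (n : ℕ) :
    ∑ k ∈ Finset.range (n + 2), (a + k * d) * r ^ k * x (n + 1 - k) =
      a * x (n + 1) + r * ∑ k ∈ Finset.range (n + 1), (a + k * d) * r ^ k * x (n - k) +
        d * r * ∑ k ∈ Finset.range (n + 1), r ^ k * x (n - k) := by
  rw [Finset.sum_range_succ', Finset.mul_sum, Finset.mul_sum, add_assoc,
    ← Finset.sum_add_distrib, add_comm]
  congr 1
  · simp
  · refine Finset.sum_congr rfl fun k _ => ?_
    rw [Nat.add_sub_add_right]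
    push_cast
    ring

/-- A solution of the arithmetic-geometric coefficient recurrence satisfies a second-order linear
recurrence from index `1` on. -/
theorem arith_geom_recurrence_second_order {a d r : ℝ} {x : ℕ → ℝ}
    (hrec : ∀ n : ℕ, x (n + 1) =
      ∑ k ∈ Finset.range (n + 1), (a + k * d) * r ^ k * x (n - k)) (n : ℕ) :
    x (n + 3) = (a + 2 * r) * x (n + 2) + r * (d - a - r) * x (n + 1) := by
  have h₂ := hrec (n + 1)
  have h₃ := hrec (n + 2)
  rw [sum_arith_geom_conv_succ, ← hrec] at h₂
  rw [sum_arith_geom_conv_succ, ← hrec, sum_geom_conv_succ] at h₃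
  linear_combination h₃ - r * h₂

/-- The arithmetic-geometric coefficient recurrence with `a = 0`, `d = 5/2`, `r = 1/2`
and initial datum `x₀ = 4/5` is solved by the Fibonacci numbers. -/
theorem fib_solves_arith_geom_recurrence
    (x : ℕ → ℝ) (hx0 : x 0 = 4 / 5)
    (hrec : ∀ n : ℕ, x (n + 1) =
      ∑ k ∈ Finset.range (n + 1), (5 * (k : ℝ) / 2) * (1 / 2 : ℝ) ^ k * x (n - k)) :
    ∀ n : ℕ, 1 ≤ n → x n = Nat.fib (n - 1) ∧
      x n = (((1 + Real.sqrt 5) / 2) ^ (n - 1) - (1 - (1 + Real.sqrt 5) / 2) ^ (n - 1)) /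
        Real.sqrt 5 := by
  have hx1 : x 1 = 0 := by simpa using hrec 0
  have hx2 : x 2 = 1 := by
    rw [hrec 1, Finset.sum_range_succ, Finset.sum_range_one]
    norm_num [hx0]
  have hrec' : ∀ n : ℕ, x (n + 1) =
      ∑ k ∈ Finset.range (n + 1), (0 + (k : ℝ) * (5 / 2)) * (1 / 2 : ℝ) ^ k * x (n - k) := by
    intro n
    rw [hrec n]
    refine Finset.sum_congr rfl fun k _ => ?_
    ring
  have hfib : ∀ m : ℕ, x (m + 1) = Nat.fib m := by
    intro m
    induction m using Nat.twoStepInduction with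
    | zero => simpa using hx1
    | one => simpa using hx2
    | more m ih₁ ih₂ =>
      rw [Nat.fib_add_two, Nat.cast_add, ← ih₁, ← ih₂]
      linear_combination arith_geom_recurrence_second_order hrec' m
  intro n hn
  obtain ⟨m, rfl⟩ := Nat.exists_eq_add_of_le' hn
  rw [Nat.add_sub_cancel]
  refine ⟨hfib m, ?_⟩
  have hconj : 1 - (1 + Real.sqrt 5) / 2 = Real.goldenConj := by
    rw [Real.goldenConj]
    ring
  rw [hfib m, Real.coe_fib_eq, hconj, Real.goldenRatio]
end

section
/- Let (xₙ) be the sequence of real numbers with x₀ = 4/9 satisfying the recurrence x_{n+1} = Σ_{k=0}^{n} (9k/2)·(1/2)^k·x_{n−k} for all n ≥ 0 (the arithmetic-geometric coefficient recurrence with a = 0, d = 9/2, r = 1/2). Then for every n ≥ 1, xₙ = (2^{n−1} − (−1)^{n−1})/3, i.e., xₙ is the Jacobsthal number J_{n−1}. -/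
/-- Closed forms for the geometric and arithmetic-geometric convolutions of a solution. -/
theorem arith_geom_convolutions_closed_form
    (x : ℕ → ℝ) (hx0 : x 0 = 4 / 9)
    (hrec : ∀ n : ℕ, x (n + 1) =
      ∑ k ∈ Finset.range (n + 1), (9 * (k : ℝ) / 2) * (1 / 2 : ℝ) ^ k * x (n - k)) (n : ℕ) :
    ∑ k ∈ Finset.range (n + 1), (1 / 2 : ℝ) ^ k * x (n - k) =
        2 / 9 * ((2 : ℝ) ^ n + (-1) ^ n) ∧
      x (n + 1) = ((2 : ℝ) ^ n - (-1) ^ n) / 3 := by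
  induction n with
  | zero => norm_num [hx0, hrec]
  | succ n ih =>
    obtain ⟨hS, hx⟩ := ih
    constructor
    · have hstep : ∑ k ∈ Finset.range (n + 1), (1 / 2 : ℝ) ^ (k + 1) * x (n - k) =
          1 / 2 * ∑ k ∈ Finset.range (n + 1), (1 / 2 : ℝ) ^ k * x (n - k) := by
        rw [Finset.mul_sum]
        exact Finset.sum_congr rfl fun k _ => by ring
      rw [Finset.sum_range_succ']
      simp only [Nat.add_sub_add_right, pow_zero, one_mul, Nat.sub_zero]
      rw [hstep, hS, hx]
      ring
    · have hstep : ∑ k ∈ Finset.range (n + 1),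
          (9 * ((k + 1 : ℕ) : ℝ) / 2) * (1 / 2 : ℝ) ^ (k + 1) * x (n - k) =
          1 / 2 * x (n + 1) +
            9 / 4 * ∑ k ∈ Finset.range (n + 1), (1 / 2 : ℝ) ^ k * x (n - k) := by
        rw [hrec n, Finset.mul_sum, Finset.mul_sum, ← Finset.sum_add_distrib]
        exact Finset.sum_congr rfl fun k _ => by push_cast; ring
      rw [hrec (n + 1), Finset.sum_range_succ']
      simp only [Nat.add_sub_add_right]
      rw [hstep, hS, hx]
      push_cast
      ring

/-- The arithmetic-geometric coefficient recurrence with `a = 0`, `d = 9/2`, `r = 1/2`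
and initial datum `x₀ = 4/9` is solved by the Jacobsthal numbers. -/
theorem jacobsthal_solves_arith_geom_recurrence
    (x : ℕ → ℝ) (hx0 : x 0 = 4 / 9)
    (hrec : ∀ n : ℕ, x (n + 1) =
      ∑ k ∈ Finset.range (n + 1), (9 * (k : ℝ) / 2) * (1 / 2 : ℝ) ^ k * x (n - k)) :
    ∀ n : ℕ, 1 ≤ n → x n = ((2 : ℝ) ^ (n - 1) - (-1 : ℝ) ^ (n - 1)) / 3 := by
  intro n hn
  obtain ⟨m, rfl⟩ := Nat.exists_eq_add_of_le' hn
  exact (arith_geom_convolutions_closed_form x hx0 hrec m).2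
end

section
/- Let (xₙ) be the sequence of real numbers with x₀ = 1/2 satisfying the recurrence x_{n+1} = Σ_{k=0}^{n} 2k·x_{n−k} for all n ≥ 0 (the arithmetic coefficient recurrence with a = 0, d = 2, r = 1). Then for every n ≥ 1, xₙ = ((1+√2)^{n−1} − (1−√2)^{n−1})/(2√2); that is, xₙ is the Pell number P_{n−1}. -/
lemma arith_recurrence_diff (x : ℕ → ℝ)
    (hrec : ∀ n : ℕ, x (n + 1) = ∑ k ∈ Finset.range (n + 1), 2 * (k : ℝ) * x (n - k)) (n : ℕ) :
    x (n + 2) = x (n + 1) + 2 * ∑ k ∈ Finset.range (n + 1), x (n - k) := by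
  rw [hrec (n + 1), hrec n, Finset.sum_range_succ', Finset.mul_sum, ← Finset.sum_add_distrib]
  simp only [Nat.add_sub_add_right, Nat.cast_zero, mul_zero, zero_mul, add_zero]
  refine Finset.sum_congr rfl fun k _ => ?_
  push_cast
  ring

lemma arith_recurrence_pell (x : ℕ → ℝ)
    (hrec : ∀ n : ℕ, x (n + 1) = ∑ k ∈ Finset.range (n + 1), 2 * (k : ℝ) * x (n - k)) (n : ℕ) :
    x (n + 3) = 2 * x (n + 2) + x (n + 1) := by
  have h₁ := arith_recurrence_diff x hrec n
  have h₂ := arith_recurrence_diff x hrec (n + 1)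
  rw [Finset.sum_range_succ'] at h₂
  simp only [Nat.add_sub_add_right, Nat.sub_zero] at h₂
  linarith

/-- The arithmetic coefficient recurrence with `a = 0`, `d = 2`, `r = 1`
and initial datum `x₀ = 1/2` is solved by the Pell numbers. -/
theorem pell_solves_arith_recurrence
    (x : ℕ → ℝ) (hx0 : x 0 = 1 / 2)
    (hrec : ∀ n : ℕ, x (n + 1) = ∑ k ∈ Finset.range (n + 1), 2 * (k : ℝ) * x (n - k)) :
    ∀ n : ℕ, 1 ≤ n →
      x n = ((1 + Real.sqrt 2) ^ (n - 1) - (1 - Real.sqrt 2) ^ (n - 1)) / (2 * Real.sqrt 2) := by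
  have hs : Real.sqrt 2 ^ 2 = 2 := Real.sq_sqrt (by norm_num)
  have hs0 : Real.sqrt 2 ≠ 0 := by positivity
  have hx1 : x 1 = 0 := by simpa using hrec 0
  have binet : ∀ m : ℕ,
      x (m + 1) = ((1 + Real.sqrt 2) ^ m - (1 - Real.sqrt 2) ^ m) / (2 * Real.sqrt 2) := by
    intro m
    induction m using Nat.twoStepInduction with
    | zero => simp [hx1]
    | one =>
      have hx2 := arith_recurrence_diff x hrec 0
      simp only [zero_add, Finset.sum_range_one, Nat.sub_zero, hx0, hx1] at hx2
      rw [hx2]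
      field_simp
      ring
    | more m ih₀ ih₁ =>
      rw [arith_recurrence_pell x hrec m, ih₀, ih₁]
      field_simp
      linear_combination ((1 - Real.sqrt 2) ^ m - (1 + Real.sqrt 2) ^ m) * hs
  intro n hn
  obtain ⟨m, rfl⟩ := Nat.exists_eq_add_of_le' hn
  exact binet m
end

section
/- Let (xₙ) be the sequence of real numbers with x₀ = 1 satisfying the recurrence x_{n+1} = xₙ + 2x_{n−1} + 3x_{n−2} + ⋯ + n·x₁ + (n+1)·x₀ = Σ_{k=0}^{n} (k+1)·x_{n−k} for all n ≥ 0. Then for every n ≥ 1, xₙ = (((3+√5)/2)ⁿ − ((3−√5)/2)ⁿ)/√5, and moreover xₙ = F_{2n}, the Fibonacci number with even index 2n. -/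
/-- Advancing a convolution against `1, 2, 3, …` by one step adds the new term and the
sum of all the earlier ones. -/
theorem sum_range_succ_mul_sub (x : ℕ → ℝ) (n : ℕ) :
    ∑ k ∈ Finset.range (n + 2), ((k : ℝ) + 1) * x (n + 1 - k) =
      ∑ k ∈ Finset.range (n + 1), ((k : ℝ) + 1) * x (n - k) +
        ∑ k ∈ Finset.range (n + 1), x k + x (n + 1) := by
  rw [Finset.sum_range_succ', ← Finset.sum_flip x, ← Finset.sum_add_distrib]
  congr 1
  · refine Finset.sum_congr rfl fun k _ => ?_
    rw [Nat.add_sub_add_right]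
    push_cast
    ring
  · simp

/-- Binet's formula for the even-indexed Fibonacci numbers. -/
theorem coe_fib_two_mul (n : ℕ) :
    (Nat.fib (2 * n) : ℝ) =
      (((3 + Real.sqrt 5) / 2) ^ n - ((3 - Real.sqrt 5) / 2) ^ n) / Real.sqrt 5 := by
  have hsq : Real.sqrt 5 ^ 2 = 5 := Real.sq_sqrt (by norm_num)
  have hφ : Real.goldenRatio ^ 2 = (3 + Real.sqrt 5) / 2 := by
    rw [Real.goldenRatio]
    linear_combination hsq / 4
  have hψ : Real.goldenConj ^ 2 = (3 - Real.sqrt 5) / 2 := by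
    rw [Real.goldenConj]
    linear_combination hsq / 4
  rw [Real.coe_fib_eq, pow_mul, pow_mul, hφ, hψ]

/-- The full-history recurrence with coefficients `1, 2, 3, …` and initial datum
`x₀ = 1` is solved by the even-indexed Fibonacci numbers. -/
theorem even_fib_solves_recurrence
    (x : ℕ → ℝ) (hx0 : x 0 = 1)
    (hrec : ∀ n : ℕ, x (n + 1) = ∑ k ∈ Finset.range (n + 1), ((k : ℝ) + 1) * x (n - k)) :
    ∀ n : ℕ, 1 ≤ n →
      x n = (((3 + Real.sqrt 5) / 2) ^ n - ((3 - Real.sqrt 5) / 2) ^ n) / Real.sqrt 5 ∧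
      x n = Nat.fib (2 * n) := by
  have key : ∀ n : ℕ, x (n + 1) = Nat.fib (2 * n + 2) ∧
      ∑ k ∈ Finset.range (n + 1), x k = Nat.fib (2 * n + 1) := by
    intro n
    induction n with
    | zero => simp [hrec 0, hx0]
    | succ n ih =>
      obtain ⟨hx, hS⟩ := ih
      have h3 : Nat.fib (2 * (n + 1) + 1) = Nat.fib (2 * n + 1) + Nat.fib (2 * n + 2) :=
        Nat.fib_add_two
      have h4 : Nat.fib (2 * (n + 1) + 2) = Nat.fib (2 * n + 2) + Nat.fib (2 * (n + 1) + 1) :=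
        Nat.fib_add_two
      constructor
      · rw [hrec (n + 1), sum_range_succ_mul_sub, ← hrec n, hS, hx, h4, h3]
        push_cast
        ring
      · rw [Finset.sum_range_succ, hS, hx, h3]
        push_cast
        ring
  intro n hn
  obtain ⟨m, rfl⟩ := Nat.exists_eq_add_of_le' hn
  have hfib : x (m + 1) = Nat.fib (2 * (m + 1)) := (key m).1
  exact ⟨hfib.trans (coe_fib_two_mul (m + 1)), hfib⟩
end

section
/- Let a, d, r, x₀ be real numbers with x₀ ≠ 0, let λ₁, λ₂ be the distinct real roots of λ² − (a+2r)λ + (r² + (a−d)r) = 0 with |λ₁| > |λ₂| and λ₁ ≠ 0, set B = a² + (a+d)r, and assume B − a·λ₂ ≠ 0. Let (xₙ) satisfy x_{n+1} = Σ_{k=0}^{n} (a + k·d)·r^k·x_{n−k} for all n ≥ 0 with initial value x₀. Then for every positive integer ρ, the ratio x_{n+ρ}/xₙ converges to λ₁^ρ as n → ∞. -/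
open Filter Topology

/-- A sequence whose coefficients are in arithmetic-geometric progression satisfies a linear
recurrence of order two from index `1` on. -/
lemma arith_geom_recurrence_order_two {R : Type*} [CommRing R] {a d r : R} {x : ℕ → R}
    (hrec : ∀ n : ℕ, x (n + 1) =
      ∑ k ∈ Finset.range (n + 1), (a + (k : R) * d) * r ^ k * x (n - k)) (n : ℕ) :
    x (n + 3) = (a + 2 * r) * x (n + 2) - (r ^ 2 + (a - d) * r) * x (n + 1) := by
  set T : ℕ → R := fun n => ∑ k ∈ Finset.range (n + 1), r ^ k * x (n - k) with hT
  have hTs (n : ℕ) : T (n + 1) = x (n + 1) + r * T n := by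
    simp only [hT]
    rw [Finset.sum_range_succ', Finset.mul_sum, add_comm]
    congr 1
    · simp
    · refine Finset.sum_congr rfl fun k _ => ?_
      rw [Nat.add_sub_add_right]
      ring
  have hxs (n : ℕ) : x (n + 2) = (a + r) * x (n + 1) + d * r * T n := by
    have h : ∑ k ∈ Finset.range (n + 1), (a + ((k + 1 : ℕ) : R) * d) * r ^ (k + 1) *
        x (n + 1 - (k + 1)) = r * x (n + 1) + d * r * T n := by
      rw [hrec n, hT, Finset.mul_sum, Finset.mul_sum, ← Finset.sum_add_distrib]
      refine Finset.sum_congr rfl fun k _ => ?_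
      rw [Nat.add_sub_add_right]
      push_cast
      ring
    rw [hrec (n + 1), Finset.sum_range_succ', h]
    simp only [Nat.cast_zero, Nat.sub_zero]
    ring
  linear_combination hxs (n + 1) + d * r * hTs n - r * hxs n

/-- Binet's formula for a linear recurrence of order two. -/
lemma binet_of_order_two_recurrence {R : Type*} [CommRing R] {l1 l2 : R} {y : ℕ → R}
    (h : ∀ n, y (n + 2) = (l1 + l2) * y (n + 1) - l1 * l2 * y n) (n : ℕ) :
    (l1 - l2) * y n = (y 1 - l2 * y 0) * l1 ^ n - (y 1 - l1 * y 0) * l2 ^ n := by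
  induction n using Nat.twoStepInduction with
  | zero => ring
  | one => ring
  | more n ih ih' =>
    rw [h n]
    linear_combination (l1 + l2) * ih' - l1 * l2 * ih

/-- If a sequence is asymptotically a nonzero multiple of `l ^ n`, then the ratios of its terms
at distance `ρ` tend to `l ^ ρ`. -/
lemma tendsto_ratio_of_tendsto_div_pow {𝕜 : Type*} [NormedField 𝕜] {l c : 𝕜} {y : ℕ → 𝕜}
    (hl : l ≠ 0) (hc : c ≠ 0) (h : Tendsto (fun n => y n / l ^ n) atTop (𝓝 c)) (ρ : ℕ) :
    Tendsto (fun n => y (n + ρ) / y n) atTop (𝓝 (l ^ ρ)) := by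
  have h' := (((tendsto_add_atTop_iff_nat ρ).2 h).div h hc).const_mul (l ^ ρ)
  rw [div_self hc, mul_one] at h'
  refine h'.congr fun n => ?_
  simp only [Pi.div_apply, pow_add]
  field_simp

/-- Convergence of the ratios `x (n+ρ) / x n` for a sequence satisfying the
recurrence with coefficients in arithmetic-geometric progression. -/
theorem arith_geom_recurrence_ratio_tendsto
    (a d r x₀ : ℝ) (hx₀ : x₀ ≠ 0)
    (l1 l2 : ℝ) (hne : l1 ≠ l2) (habs : |l1| > |l2|) (hl1 : l1 ≠ 0)
    (hsum : l1 + l2 = a + 2 * r) (hprod : l1 * l2 = r ^ 2 + (a - d) * r)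
    (B : ℝ) (hB : B = a ^ 2 + (a + d) * r) (hBa : B - a * l2 ≠ 0)
    (x : ℕ → ℝ) (hx0 : x 0 = x₀)
    (hrec : ∀ n : ℕ, x (n + 1) =
      ∑ k ∈ Finset.range (n + 1), (a + (k : ℝ) * d) * r ^ k * x (n - k)) :
    ∀ ρ : ℕ, 1 ≤ ρ →
      Tendsto (fun n : ℕ => x (n + ρ) / x n) atTop (𝓝 (l1 ^ ρ)) := by
  intro ρ _
  have hsub : l1 - l2 ≠ 0 := sub_ne_zero.2 hne
  have hx1 : x 1 = a * x₀ := by simp [hrec 0, hx0]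
  have hx2 : x 2 = B * x₀ := by
    have h := hrec 1
    simp only [Finset.sum_range_succ, Finset.sum_range_zero] at h
    norm_num [hx0, hx1] at h
    rw [h, hB]
    ring
  have hbinet := binet_of_order_two_recurrence (l1 := l1) (l2 := l2) (y := fun n => x (n + 1))
    fun n => by rw [hsum, hprod]; exact arith_geom_recurrence_order_two hrec n
  simp only [zero_add, Nat.reduceAdd, hx1, hx2] at hbinet
  have hq : Tendsto (fun n : ℕ => (l2 / l1) ^ n) atTop (𝓝 0) := by
    apply tendsto_pow_atTop_nhds_zero_of_abs_lt_one
    rwa [abs_div, div_lt_one (abs_pos.2 hl1)]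
  have hlim : Tendsto (fun n => x (n + 1) / l1 ^ n) atTop
      (𝓝 (x₀ * (B - a * l2) / (l1 - l2))) := by
    have h := ((hq.const_mul (x₀ * (B - a * l1))).const_sub
      (x₀ * (B - a * l2))).div_const (l1 - l2)
    rw [mul_zero, sub_zero] at h
    refine h.congr fun n => ?_
    have hn := hbinet n
    rw [div_pow, div_eq_div_iff hsub (pow_ne_zero n hl1), sub_mul, mul_assoc _ (_ / _),
      div_mul_cancel₀ _ (pow_ne_zero n hl1)]
    linear_combination -hn
  have h := tendsto_ratio_of_tendsto_div_pow hl1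
    (div_ne_zero (mul_ne_zero hx₀ hBa) hsub) hlim ρ
  refine (tendsto_add_atTop_iff_nat 1).1 (h.congr fun n => ?_)
  rw [add_right_comm]
end
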